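/- Let L̃ = ℓ + (2ℓ² + ρM)/μ + (ℓ³ + 2ρℓM)/μ² + ρℓ²M/μ³ and let σ > 0. Suppose w ∈ E, y ∈ F and v ∈ F satisfy ‖y − y*(w)‖ ≤ σ/(2L̃) and ‖v − (∇²_{yy} g(w,y))⁻¹ ∇_y f(w,y)‖ ≤ σ/(2ℓ). Then the inexact hypergradient ĝ = ∇_x f(w,y) − ∇²_{xy} g(w,y) v satisfies ‖∇Φ(w) − ĝ‖ ≤ σ. -/

import Mathlib

open Real Set

noncomputable section

variable {E F : Type*}
  [NormedAddCommGroup E] [InnerProductSpace ℝ E] [FiniteDimensional ℝ E]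
  [NormedAddCommGroup F] [InnerProductSpace ℝ F] [FiniteDimensional ℝ F]

/-- The point `(x, y)` of the `ℓ²` product `WithLp 2 (E × F)`. -/
abbrev pmk (x : E) (y : F) : WithLp 2 (E × F) :=
  (WithLp.equiv 2 (E × F)).symm (x, y)

/-- The partial gradient `∇_x f(x, y) ∈ E`. -/
def gradx (f : WithLp 2 (E × F) → ℝ) (x : E) (y : F) : E :=
  ((WithLp.equiv 2 (E × F)) (gradient f (pmk x y))).1

/-- The partial gradient `∇_y f(x, y) ∈ F`. -/
def grady (f : WithLp 2 (E × F) → ℝ) (x : E) (y : F) : F :=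
  ((WithLp.equiv 2 (E × F)) (gradient f (pmk x y))).2

/-- The partial Hessian `∇²_{yy} g(x, y) : F → F`. -/
def hessyy (g : WithLp 2 (E × F) → ℝ) (x : E) (y : F) : F →L[ℝ] F :=
  fderiv ℝ (fun y' : F => grady g x y') y

/-- The mixed second partial derivative `∇²_{xy} g(x, y) : F → E`. -/
def hessxy (g : WithLp 2 (E × F) → ℝ) (x : E) (y : F) : F →L[ℝ] E :=
  fderiv ℝ (fun y' : F => gradx g x y') y

section Convex

variable {V : Type*} [NormedAddCommGroup V] [InnerProductSpace ℝ V]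

/-- The derivative of a convex function is monotone. -/
theorem ConvexOn.hasFDerivAt_monotone {k : V → ℝ} {k' : V → V →L[ℝ] ℝ}
    (hk : ConvexOn ℝ Set.univ k) (hd : ∀ z, HasFDerivAt k (k' z) z) (a b : V) :
    k' b (a - b) ≤ k' a (a - b) := by
  have hline : ∀ t : ℝ, HasDerivAt (fun t : ℝ => k (AffineMap.lineMap b a t))
      (k' (AffineMap.lineMap b a t) (a - b)) t := fun t =>
    (hd _).comp_hasDerivAt t AffineMap.hasDerivAt_lineMap
  have hconv : ConvexOn ℝ Set.univ (fun t : ℝ => k (AffineMap.lineMap b a t)) := by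
    exact hk.comp_affineMap (AffineMap.lineMap b a : ℝ →ᵃ[ℝ] V)
  have h0 := hconv.le_slope_of_hasDerivAt (Set.mem_univ 0) (Set.mem_univ 1) one_pos (hline 0)
  have h1 := hconv.slope_le_of_hasDerivAt (Set.mem_univ 0) (Set.mem_univ 1) one_pos (hline 1)
  simpa using h0.trans h1

/-- The gradient of a strongly convex function is strongly monotone. -/
theorem mul_norm_sq_le_inner_of_convexOn_sub [CompleteSpace V] {h : V → ℝ} {h' : V → V} {μ : ℝ}
    (hd : ∀ z, HasGradientAt h (h' z) z)
    (hc : ConvexOn ℝ Set.univ (fun z => h z - μ / 2 * ‖z‖ ^ 2)) (a b : V) :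
    μ * ‖a - b‖ ^ 2 ≤ inner ℝ (h' a - h' b) (a - b) := by
  have hk : ∀ z, HasFDerivAt (fun z => h z - μ / 2 * ‖z‖ ^ 2)
      (InnerProductSpace.toDual ℝ V (h' z) - (μ / 2) • (2 • innerSL ℝ z)) z := fun z =>
    (hd z).hasFDerivAt.sub ((hasStrictFDerivAt_norm_sq z).hasFDerivAt.const_mul (μ / 2))
  have hmono := hc.hasFDerivAt_monotone hk a b
  simp only [sub_apply, smul_apply, InnerProductSpace.toDual_apply_apply, innerSL_apply_apply,
    nsmul_eq_mul, smul_eq_mul, Nat.cast_ofNat] at hmono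
  have hsq : ‖a - b‖ ^ 2 = inner ℝ a (a - b) - inner ℝ b (a - b) := by
    rw [← inner_sub_left, real_inner_self_eq_norm_sq]
  rw [hsq, inner_sub_left]
  linarith

/-- A map satisfying the strong monotonicity inequality expands distances. -/
theorem mul_norm_le_of_mul_norm_sq_le_inner {μ : ℝ} {r s : V}
    (h : μ * ‖s‖ ^ 2 ≤ inner ℝ r s) : μ * ‖s‖ ≤ ‖r‖ := by
  rcases eq_or_ne s 0 with rfl | hs
  · simp
  · have hpos : 0 < ‖s‖ := norm_pos_iff.mpr hs
    have := h.trans (real_inner_le_norm r s)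
    exact le_of_mul_le_mul_right (by linarith [sq ‖s‖, mul_assoc μ ‖s‖ ‖s‖]) hpos

end Convex

section Normed

variable {V W : Type*} [NormedAddCommGroup V] [NormedSpace ℝ V]
  [NormedAddCommGroup W] [NormedSpace ℝ W]

/-- The derivative of a map expanding distances by a factor `μ` expands norms by `μ`. -/
theorem HasFDerivAt.mul_norm_le {G : V → W} {B : V →L[ℝ] W} {y : V} {μ : ℝ}
    (hG : HasFDerivAt G B y) (h : ∀ z, μ * ‖z - y‖ ≤ ‖G z - G y‖) (u : V) :
    μ * ‖u‖ ≤ ‖B u‖ := by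
  refine ge_of_tendsto (hG.lim_real u).norm ?_
  filter_upwards [Filter.eventually_gt_atTop (0 : ℝ)] with c hc
  have := h (y + c⁻¹ • u)
  rw [add_sub_cancel_left, norm_smul, Real.norm_of_nonneg (by positivity)] at this
  rw [norm_smul, Real.norm_of_nonneg hc.le]
  calc μ * ‖u‖ = c * (μ * (c⁻¹ * ‖u‖)) := by field_simp
    _ ≤ _ := by gcongr

/-- An endomorphism of a finite-dimensional space that is bounded below is invertible. -/
theorem ContinuousLinearMap.isInvertible_of_mul_norm_le [FiniteDimensional ℝ V] {B : V →L[ℝ] V}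
    {μ : ℝ} (hμ : 0 < μ) (h : ∀ u, μ * ‖u‖ ≤ ‖B u‖) : B.IsInvertible := by
  have hinj : Function.Injective (B : V →ₗ[ℝ] V) := by
    refine (injective_iff_map_eq_zero _).mpr fun u hu => norm_le_zero_iff.mp ?_
    have hu' : B u = 0 := hu
    have := h u
    rw [hu', norm_zero] at this
    exact nonpos_of_mul_nonpos_right this hμ
  exact ⟨(LinearEquiv.ofInjectiveEndo (B : V →ₗ[ℝ] V) hinj).toContinuousLinearEquiv, by ext; rfl⟩

/-- A bounded map with constant derivative is constant. -/
theorem eq_of_fderiv_eq_of_norm_le {T : V → W} (hT : Differentiable ℝ T)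
    (hT' : ∀ p q, fderiv ℝ T p = fderiv ℝ T q) {M : ℝ} (hM : ∀ p, ‖T p‖ ≤ M) (p q : V) :
    T p = T q := by
  refine is_const_of_fderiv_eq_zero hT (fun r => ?_) p q
  have haff : ∀ z, T z - fderiv ℝ T r z = T 0 - fderiv ℝ T r 0 := fun z =>
    is_const_of_fderiv_eq_zero (f := fun z => T z - fderiv ℝ T r z)
      (hT.sub (fderiv ℝ T r).differentiable)
      (fun s => by
        rw [fderiv_fun_sub (hT s) (fderiv ℝ T r).differentiableAt, ContinuousLinearMap.fderiv,
          hT' s r, sub_self]) z 0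
  ext u
  by_contra hu
  have hpos : 0 < ‖fderiv ℝ T r u‖ := norm_pos_iff.mpr hu
  obtain ⟨n, hn⟩ := exists_nat_gt ((M + M) / ‖fderiv ℝ T r u‖)
  rw [div_lt_iff₀ hpos] at hn
  have hval : (n : ℝ) • fderiv ℝ T r u = T ((n : ℝ) • u) - T 0 := by
    have := haff ((n : ℝ) • u)
    rw [map_smul, map_zero, sub_zero] at this
    rw [← this]; abel
  have hle := (norm_sub_le (T ((n : ℝ) • u)) (T 0)).trans (add_le_add (hM _) (hM _))
  rw [← hval, norm_smul, Real.norm_natCast] at hle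
  linarith

/-- Differentiation of a Lipschitz implicit function. -/
theorem HasFDerivAt.implicit_of_lipschitz {U P : Type*} [NormedAddCommGroup U] [NormedSpace ℝ U]
    [NormedAddCommGroup P] [NormedSpace ℝ P] {G : P → W} {A : P →L[ℝ] W}
    {i : U →L[ℝ] P} {j : V →L[ℝ] P} {φ : U → V} {w : U}
    (hG : HasFDerivAt G A (i w + j (φ w))) (hzero : ∀ x, G (i x + j (φ x)) = 0)
    {K : NNReal} (hφ : LipschitzWith K φ) (hB : (A ∘L j).IsInvertible) :
    HasFDerivAt φ (-((A ∘L j).inverse ∘L A ∘L i)) w := by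
  have hφO : (fun x => φ x - φ w) =O[nhds w] fun x => x - w :=
    Asymptotics.IsBigO.of_bound K (Filter.Eventually.of_forall fun x => hφ.norm_sub_le x w)
  have hpO : (fun x => i x + j (φ x) - (i w + j (φ w))) =O[nhds w] fun x => x - w := by
    have := (i.isBigO_sub (nhds w) w).add ((j.isBigO_comp (fun x => φ x - φ w) _).trans hφO)
    refine this.congr_left fun x => ?_
    simp only [map_sub]; abel
  have hcont : Filter.Tendsto (fun x => i x + j (φ x)) (nhds w) (nhds (i w + j (φ w))) :=
    (i.continuous.add (j.continuous.comp hφ.continuous)).tendsto w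
  have hA := (hG.isLittleO.comp_tendsto hcont).trans_isBigO hpO
  have hinv := ((A ∘L j).inverse.isBigO_comp _ (nhds w)).trans_isLittleO hA
  refine .of_isLittleO (hinv.neg_left.congr_left fun x => ?_)
  have := hB.inverse_apply_self (φ x - φ w)
  simp only [ContinuousLinearMap.comp_apply, map_sub] at this
  simp only [Function.comp_apply, hzero, sub_zero, zero_sub, map_neg, map_sub, map_add, neg_neg,
    neg_apply, ContinuousLinearMap.comp_apply]
  rw [← this]
  abel

/-- Perturbation bound for `C z`, where `z` solves the linear equation `B z = a`. -/
theorem norm_apply_sub_apply_le_of_perturbation {C C' : V →L[ℝ] W} {B B' : V →L[ℝ] V} {z z' : V}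
    {μ ℓ ℓ' r m d : ℝ} (hμ : 0 < μ)
    (hB : ∀ u, μ * ‖u‖ ≤ ‖B u‖) (hB' : ∀ u, μ * ‖u‖ ≤ ‖B' u‖)
    (hm : ‖B' z'‖ ≤ m) (ha : ‖B' z' - B z‖ ≤ ℓ' * d) (hC : ‖C‖ ≤ ℓ)
    (hCC : ‖C' - C‖ ≤ r * d) (hBB : ‖B - B'‖ ≤ r * d) :
    ‖C' z' - C z‖ ≤ (r * m / μ + ℓ * ((ℓ' + r * m / μ) / μ)) * d := by
  have hz' : ‖z'‖ ≤ m / μ := by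
    rw [le_div_iff₀ hμ]; linarith [hB' z']
  have hscale : r * d * (m / μ) = r * m / μ * d := by ring
  have hz : ‖z' - z‖ ≤ (ℓ' + r * m / μ) / μ * d := by
    have hBz : B (z' - z) = (B' z' - B z) + (B - B') z' := by
      simp only [map_sub, sub_apply]; abel
    rw [div_mul_eq_mul_div, le_div_iff₀ hμ]
    have h1 := hB (z' - z)
    have h2 := norm_add_le (B' z' - B z) ((B - B') z')
    rw [← hBz] at h2
    linarith [(B - B').le_of_opNorm_le_of_le hBB hz']
  have hsplit : C' z' - C z = (C' - C) z' + C (z' - z) := by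
    simp only [map_sub, sub_apply]; abel
  rw [hsplit]
  refine (norm_add_le _ _).trans ?_
  linarith [(C' - C).le_of_opNorm_le_of_le hCC hz', C.le_of_opNorm_le_of_le hC hz]

end Normed

section Inclusions

omit [FiniteDimensional ℝ E] [FiniteDimensional ℝ F]

/-- The inclusion of the first factor into `WithLp 2 (E × F)`. -/
def inlL2 (E F : Type*) [NormedAddCommGroup E] [InnerProductSpace ℝ E]
    [NormedAddCommGroup F] [InnerProductSpace ℝ F] : E →L[ℝ] WithLp 2 (E × F) :=
  (WithLp.prodContinuousLinearEquiv 2 ℝ E F).symm.toContinuousLinearMap ∘L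
    ContinuousLinearMap.inl ℝ E F

/-- The inclusion of the second factor into `WithLp 2 (E × F)`. -/
def inrL2 (E F : Type*) [NormedAddCommGroup E] [InnerProductSpace ℝ E]
    [NormedAddCommGroup F] [InnerProductSpace ℝ F] : F →L[ℝ] WithLp 2 (E × F) :=
  (WithLp.prodContinuousLinearEquiv 2 ℝ E F).symm.toContinuousLinearMap ∘L
    ContinuousLinearMap.inr ℝ E F

theorem pmk_eq_add (x : E) (y : F) : pmk x y = inlL2 E F x + inrL2 E F y := by
  change WithLp.toLp 2 (x, y) = WithLp.toLp 2 ((x, 0) + (0, y))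
  simp

theorem norm_inlL2_apply (x : E) : ‖inlL2 E F x‖ = ‖x‖ :=
  WithLp.norm_toLp_fst 2 E F x

theorem norm_inrL2_apply (y : F) : ‖inrL2 E F y‖ = ‖y‖ :=
  WithLp.norm_toLp_snd 2 E F y

theorem inner_inlL2_right (p : WithLp 2 (E × F)) (x : E) :
    inner ℝ p (inlL2 E F x) = inner ℝ (WithLp.fstL 2 ℝ E F p) x := by
  rw [WithLp.prod_inner_apply]
  change inner ℝ p.fst x + inner ℝ p.snd 0 = inner ℝ p.fst x
  rw [inner_zero_right, add_zero]

theorem inner_inrL2_right (p : WithLp 2 (E × F)) (y : F) :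
    inner ℝ p (inrL2 E F y) = inner ℝ (WithLp.sndL 2 ℝ E F p) y := by
  rw [WithLp.prod_inner_apply]
  change inner ℝ p.fst 0 + inner ℝ p.snd y = inner ℝ p.snd y
  rw [inner_zero_right, zero_add]

theorem norm_fstL_apply_le (p : WithLp 2 (E × F)) : ‖WithLp.fstL 2 ℝ E F p‖ ≤ ‖p‖ :=
  WithLp.norm_fst_le _ p

theorem norm_sndL_apply_le (p : WithLp 2 (E × F)) : ‖WithLp.sndL 2 ℝ E F p‖ ≤ ‖p‖ :=
  WithLp.norm_snd_le _ p

theorem norm_fstL_comp_comp_inrL2_le (H : WithLp 2 (E × F) →L[ℝ] WithLp 2 (E × F)) :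
    ‖WithLp.fstL 2 ℝ E F ∘L H ∘L inrL2 E F‖ ≤ ‖H‖ :=
  ContinuousLinearMap.opNorm_le_bound _ (norm_nonneg H) fun u => by
    rw [← norm_inrL2_apply (E := E) u]
    exact (norm_fstL_apply_le _).trans (H.le_opNorm _)

theorem norm_sndL_comp_comp_inrL2_le (H : WithLp 2 (E × F) →L[ℝ] WithLp 2 (E × F)) :
    ‖WithLp.sndL 2 ℝ E F ∘L H ∘L inrL2 E F‖ ≤ ‖H‖ :=
  ContinuousLinearMap.opNorm_le_bound _ (norm_nonneg H) fun u => by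
    rw [← norm_inrL2_apply (E := E) u]
    exact (norm_sndL_apply_le _).trans (H.le_opNorm _)

theorem hasFDerivAt_pmk_right (x : E) (y : F) :
    HasFDerivAt (fun y' : F => pmk x y') (inrL2 E F) y := by
  simp only [pmk_eq_add]
  exact (inrL2 E F).hasFDerivAt.const_add _

end Inclusions

section PartialDerivatives

variable {f g : WithLp 2 (E × F) → ℝ}

theorem gradx_eq_fstL (f : WithLp 2 (E × F) → ℝ) (x : E) (y : F) :
    gradx f x y = WithLp.fstL 2 ℝ E F (gradient f (pmk x y)) := rfl

theorem grady_eq_sndL (f : WithLp 2 (E × F) → ℝ) (x : E) (y : F) :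
    grady f x y = WithLp.sndL 2 ℝ E F (gradient f (pmk x y)) := rfl

theorem hasFDerivAt_grady (hg : Differentiable ℝ (gradient g)) (x : E) (y : F) :
    HasFDerivAt (fun y' : F => grady g x y')
      (WithLp.sndL 2 ℝ E F ∘L fderiv ℝ (gradient g) (pmk x y) ∘L inrL2 E F) y :=
  (WithLp.sndL 2 ℝ E F).hasFDerivAt.comp y
    ((hg (pmk x y)).hasFDerivAt.comp y (hasFDerivAt_pmk_right x y))

theorem hessyy_eq (hg : Differentiable ℝ (gradient g)) (x : E) (y : F) :
    hessyy g x y = WithLp.sndL 2 ℝ E F ∘L fderiv ℝ (gradient g) (pmk x y) ∘L inrL2 E F :=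
  (hasFDerivAt_grady hg x y).fderiv

theorem hessxy_eq (hg : Differentiable ℝ (gradient g)) (x : E) (y : F) :
    hessxy g x y = WithLp.fstL 2 ℝ E F ∘L fderiv ℝ (gradient g) (pmk x y) ∘L inrL2 E F :=
  ((WithLp.fstL 2 ℝ E F).hasFDerivAt.comp y
    ((hg (pmk x y)).hasFDerivAt.comp y (hasFDerivAt_pmk_right x y))).fderiv

theorem hasGradientAt_grady (hg : Differentiable ℝ g) (x : E) (y : F) :
    HasGradientAt (fun y' : F => g (pmk x y')) (grady g x y) y := by
  have h := (hg (pmk x y)).hasGradientAt.hasFDerivAt.comp y (hasFDerivAt_pmk_right x y)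
  refine hasGradientAt_iff_hasFDerivAt.mpr (h.congr_fderiv ?_)
  ext u
  exact inner_inrL2_right _ u

/-- The derivative of a gradient is a symmetric operator. -/
theorem inner_fderiv_gradient_comm {P : Type*} [NormedAddCommGroup P] [InnerProductSpace ℝ P]
    [CompleteSpace P] {g : P → ℝ} (hg : Differentiable ℝ g) (hg2 : Differentiable ℝ (gradient g))
    (p u v : P) :
    inner ℝ (fderiv ℝ (gradient g) p u) v = inner ℝ (fderiv ℝ (gradient g) p v) u := by
  have h := (InnerProductSpace.toDual ℝ P).toContinuousLinearEquiv.toContinuousLinearMap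
    |>.hasFDerivAt.comp p (hg2 p).hasFDerivAt
  exact second_derivative_symmetric (fun y => (hg y).hasGradientAt.hasFDerivAt) h u v

variable {μ : ℝ}

theorem mul_norm_sub_le_norm_grady_sub (hg : Differentiable ℝ g) {x : E}
    (hsc : ConvexOn ℝ Set.univ (fun y : F => g (pmk x y) - μ / 2 * ‖y‖ ^ 2)) (y y' : F) :
    μ * ‖y - y'‖ ≤ ‖grady g x y - grady g x y'‖ :=
  mul_norm_le_of_mul_norm_sq_le_inner
    (mul_norm_sq_le_inner_of_convexOn_sub (hasGradientAt_grady hg x) hsc y y')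

theorem mul_norm_le_norm_hessyy (hg : Differentiable ℝ g) (hg2 : Differentiable ℝ (gradient g))
    {x : E} (hsc : ConvexOn ℝ Set.univ (fun y : F => g (pmk x y) - μ / 2 * ‖y‖ ^ 2)) (y u : F) :
    μ * ‖u‖ ≤ ‖hessyy g x y u‖ := by
  rw [hessyy_eq hg2]
  exact (hasFDerivAt_grady hg2 x y).mul_norm_le
    (fun z => mul_norm_sub_le_norm_grady_sub hg hsc z y) u

theorem grady_eq_zero_of_forall_le (hg : Differentiable ℝ g) {x : E} {y : F}
    (hmin : ∀ y', g (pmk x y) ≤ g (pmk x y')) : grady g x y = 0 := by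
  have hloc : IsLocalMin (fun y' : F => g (pmk x y')) y := Filter.Eventually.of_forall hmin
  have h := hloc.hasFDerivAt_eq_zero (hasGradientAt_grady hg x y).hasFDerivAt
  exact (map_eq_zero_iff _ (InnerProductSpace.toDual ℝ F).injective).mp h

theorem lipschitzWith_argmin (hμ : 0 < μ) {K : NNReal} (hg : Differentiable ℝ g)
    (hglip : LipschitzWith K (gradient g))
    (hsc : ∀ x : E, ConvexOn ℝ Set.univ (fun y : F => g (pmk x y) - μ / 2 * ‖y‖ ^ 2))
    {ystar : E → F} (hzero : ∀ x, grady g x (ystar x) = 0) :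
    LipschitzWith (K / μ.toNNReal) ystar := by
  refine LipschitzWith.of_dist_le_mul fun x x' => ?_
  rw [dist_eq_norm, dist_eq_norm, NNReal.coe_div, Real.coe_toNNReal μ hμ.le,
    div_mul_eq_mul_div, le_div_iff₀ hμ, mul_comm]
  have h := mul_norm_sub_le_norm_grady_sub hg (hsc x) (ystar x) (ystar x')
  rw [hzero x, ← hzero x', grady_eq_sndL, grady_eq_sndL, ← map_sub] at h
  refine h.trans ((norm_sndL_apply_le _).trans ((hglip.norm_sub_le _ _).trans_eq ?_))
  rw [pmk_eq_add, pmk_eq_add, add_sub_add_right_eq_sub, ← map_sub, norm_inlL2_apply,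
    norm_sub_rev]

/-- The hypergradient formula, obtained by implicit differentiation. -/
theorem hasGradientAt_comp_argmin (hμ : 0 < μ) {K : NNReal} (hg : Differentiable ℝ g)
    (hg2 : Differentiable ℝ (gradient g)) (hglip : LipschitzWith K (gradient g))
    (hsc : ∀ x : E, ConvexOn ℝ Set.univ (fun y : F => g (pmk x y) - μ / 2 * ‖y‖ ^ 2))
    {ystar : E → F} (hmin : ∀ x : E, ∀ y : F, g (pmk x (ystar x)) ≤ g (pmk x y))
    (hf : Differentiable ℝ f) (w : E) :
    HasGradientAt (fun x => f (pmk x (ystar x)))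
      (gradx f w (ystar w)
        - hessxy g w (ystar w) ((hessyy g w (ystar w)).inverse (grady f w (ystar w)))) w := by
  have hzero x := grady_eq_zero_of_forall_le hg (hmin x)
  have hinv : (hessyy g w (ystar w)).IsInvertible :=
    ContinuousLinearMap.isInvertible_of_mul_norm_le hμ
      (mul_norm_le_norm_hessyy hg hg2 (hsc w) (ystar w))
  set A := WithLp.sndL 2 ℝ E F ∘L fderiv ℝ (gradient g) (pmk w (ystar w)) with hA
  have hAB : A ∘L inrL2 E F = hessyy g w (ystar w) := by
    rw [hessyy_eq hg2, hA, ContinuousLinearMap.comp_assoc]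
  have hG : HasFDerivAt (fun p => WithLp.sndL 2 ℝ E F (gradient g p)) A
      (inlL2 E F w + inrL2 E F (ystar w)) := by
    rw [← pmk_eq_add]
    exact (WithLp.sndL 2 ℝ E F).hasFDerivAt.comp _ (hg2 _).hasFDerivAt
  have hystar := hG.implicit_of_lipschitz
    (fun x => by rw [← pmk_eq_add]; exact hzero x)
    (lipschitzWith_argmin hμ hg hglip hsc hzero) (by rwa [hAB])
  rw [hAB] at hystar
  have hpath := (inlL2 E F).hasFDerivAt.add ((inrL2 E F).hasFDerivAt.comp w hystar)
  have hΦ := (hf (pmk w (ystar w))).hasGradientAt.hasFDerivAt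
  rw [pmk_eq_add] at hΦ
  have hcomp := hΦ.comp w hpath
  have hfun : (fun x => f (pmk x (ystar x)))
      = f ∘ (⇑(inlL2 E F) + ⇑(inrL2 E F) ∘ ystar) := by
    ext x; simp [pmk_eq_add]
  rw [hfun]
  refine hasGradientAt_iff_hasFDerivAt.mpr (hcomp.congr_fderiv ?_)
  rw [← pmk_eq_add]
  ext h
  set z := (hessyy g w (ystar w)).inverse (grady f w (ystar w)) with hz
  set k := (hessyy g w (ystar w)).inverse (A (inlL2 E F h)) with hk
  have hBz : hessyy g w (ystar w) z = grady f w (ystar w) := hinv.self_apply_inverse _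
  have hBk : hessyy g w (ystar w) k = A (inlL2 E F h) := hinv.self_apply_inverse _
  have hxy : inner ℝ (hessxy g w (ystar w) z) h = inner ℝ (grady f w (ystar w)) k := by
    calc inner ℝ (hessxy g w (ystar w) z) h
        = inner ℝ (fderiv ℝ (gradient g) (pmk w (ystar w)) (inrL2 E F z)) (inlL2 E F h) := by
          rw [inner_inlL2_right, hessxy_eq hg2]; rfl
      _ = inner ℝ (A (inlL2 E F h)) z := by
          rw [inner_fderiv_gradient_comm hg hg2, inner_inrL2_right]; rfl
      _ = inner ℝ (hessyy g w (ystar w) z) k := by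
          rw [← hBk, hessyy_eq hg2]
          simp only [ContinuousLinearMap.comp_apply]
          rw [← inner_inrL2_right, inner_fderiv_gradient_comm hg hg2, inner_inrL2_right]
      _ = _ := by rw [hBz]
  simp only [ContinuousLinearMap.comp_apply, add_apply, neg_apply,
    InnerProductSpace.toDual_apply_apply, inner_sub_left, inner_add_right, map_neg,
    inner_neg_right, inner_inlL2_right, inner_inrL2_right, hxy]
  rfl

/-- Lipschitz bound in `y` for the hypergradient `∇_x f - ∇²_{xy} g (∇²_{yy} g)⁻¹ ∇_y f`. -/
theorem norm_hypergradient_sub_le (hμ : 0 < μ) {K L r m : NNReal} (hg : Differentiable ℝ g)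
    (hg2 : Differentiable ℝ (gradient g)) (hglip : LipschitzWith K (gradient g))
    (hghess : LipschitzWith r (fun p => fderiv ℝ (gradient g) p)) {w : E}
    (hsc : ConvexOn ℝ Set.univ (fun y : F => g (pmk w y) - μ / 2 * ‖y‖ ^ 2))
    (hfm : ∀ p, ‖gradient f p‖ ≤ m) (hflip : LipschitzWith L (gradient f)) (y y' : F) :
    ‖(gradx f w y' - hessxy g w y' ((hessyy g w y').inverse (grady f w y')))
      - (gradx f w y - hessxy g w y ((hessyy g w y).inverse (grady f w y)))‖
      ≤ (L + (r * m / μ + K * ((L + r * m / μ) / μ))) * ‖y' - y‖ := by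
  have hB y u := mul_norm_le_norm_hessyy hg hg2 hsc y u
  have hinv y := ContinuousLinearMap.isInvertible_of_mul_norm_le hμ (hB y)
  have hp : ‖pmk w y' - pmk w y‖ = ‖y' - y‖ := by
    rw [pmk_eq_add, pmk_eq_add, add_sub_add_left_eq_sub, ← map_sub, norm_inrL2_apply]
  have hp' : ‖pmk w y - pmk w y'‖ = ‖y' - y‖ := by rw [norm_sub_rev, hp]
  have hgradx : ‖gradx f w y' - gradx f w y‖ ≤ L * ‖y' - y‖ := by
    rw [gradx_eq_fstL, gradx_eq_fstL, ← map_sub, ← hp]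
    exact (norm_fstL_apply_le _).trans (hflip.norm_sub_le _ _)
  have hgrady : ‖grady f w y' - grady f w y‖ ≤ L * ‖y' - y‖ := by
    rw [grady_eq_sndL, grady_eq_sndL, ← map_sub, ← hp]
    exact (norm_sndL_apply_le _).trans (hflip.norm_sub_le _ _)
  have hC : ‖hessxy g w y‖ ≤ K := by
    rw [hessxy_eq hg2]
    exact (norm_fstL_comp_comp_inrL2_le _).trans (norm_fderiv_le_of_lipschitz ℝ hglip)
  have hCC : ‖hessxy g w y' - hessxy g w y‖ ≤ r * ‖y' - y‖ := by
    rw [hessxy_eq hg2, hessxy_eq hg2, ← ContinuousLinearMap.comp_sub,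
      ← ContinuousLinearMap.sub_comp, ← hp]
    exact (norm_fstL_comp_comp_inrL2_le _).trans (hghess.norm_sub_le _ _)
  have hBB : ‖hessyy g w y - hessyy g w y'‖ ≤ r * ‖y' - y‖ := by
    rw [hessyy_eq hg2, hessyy_eq hg2, ← ContinuousLinearMap.comp_sub,
      ← ContinuousLinearMap.sub_comp, ← hp']
    exact (norm_sndL_comp_comp_inrL2_le _).trans (hghess.norm_sub_le _ _)
  have hmain := norm_apply_sub_apply_le_of_perturbation
    (z := (hessyy g w y).inverse (grady f w y)) (z' := (hessyy g w y').inverse (grady f w y'))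
    hμ (hB y) (hB y') (m := m) (ℓ' := L) (by
      rw [(hinv y').self_apply_inverse]
      exact (norm_sndL_apply_le _).trans (hfm _)) (by
      rwa [(hinv y').self_apply_inverse, (hinv y).self_apply_inverse]) hC hCC hBB
  rw [sub_sub_sub_comm, add_mul]
  exact (norm_sub_le _ _).trans (add_le_add hgradx hmain)

end PartialDerivatives

/-- **Accuracy of the inexact hypergradient.**
If `‖y − y*(w)‖ ≤ σ/(2L̃)` with `L̃ = ℓ + (2ℓ² + ρM)/μ + (ℓ³ + 2ρℓM)/μ² + ρℓ²M/μ³`,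
and `‖v − (∇²_{yy} g(w,y))⁻¹ ∇_y f(w,y)‖ ≤ σ/(2ℓ)`, then the inexact hypergradient
`ĝ = ∇_x f(w,y) − ∇²_{xy} g(w,y) v` satisfies `‖∇Φ(w) − ĝ‖ ≤ σ`. -/
theorem inexact_hypergradient_bound
    (g : WithLp 2 (E × F) → ℝ) (ℓ μ M ρ σ : ℝ) (hμ : 0 < μ) (hμℓ : μ ≤ ℓ) (hσ : 0 < σ)
    (hgdiff : Differentiable ℝ g) (hgdiff2 : Differentiable ℝ (gradient g))
    (hglip : LipschitzWith ℓ.toNNReal (gradient g))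
    (hghess : LipschitzWith ρ.toNNReal (fun p => fderiv ℝ (gradient g) p))
    (hsc : ∀ x : E, ConvexOn ℝ Set.univ (fun y : F => g (pmk x y) - μ / 2 * ‖y‖ ^ 2))
    (ystar : E → F)
    (hmin : ∀ x : E, ∀ y : F, g (pmk x (ystar x)) ≤ g (pmk x y))
    (f : WithLp 2 (E × F) → ℝ)
    (hfdiff : Differentiable ℝ f) (hfdiff2 : Differentiable ℝ (gradient f))
    (hfM : LipschitzWith M.toNNReal f)
    (hflip : LipschitzWith ℓ.toNNReal (gradient f))
    (hfhess : LipschitzWith ρ.toNNReal (fun p => fderiv ℝ (gradient f) p))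
    (Φ : E → ℝ) (hΦ : ∀ x : E, Φ x = f (pmk x (ystar x)))
    (Ltil : ℝ)
    (hLtil : Ltil = ℓ + (2 * ℓ ^ 2 + ρ * M) / μ + (ℓ ^ 3 + 2 * ρ * ℓ * M) / μ ^ 2
      + ρ * ℓ ^ 2 * M / μ ^ 3)
    (w : E) (y v : F)
    (hy : ‖y - ystar w‖ ≤ σ / (2 * Ltil))
    (hv : ‖v - (hessyy g w y).inverse (grady f w y)‖ ≤ σ / (2 * ℓ)) :
    ‖gradient Φ w - (gradx f w y - hessxy g w y v)‖ ≤ σ := by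
  have hℓ : 0 < ℓ := hμ.trans_le hμℓ
  have hfm : ∀ p, ‖gradient f p‖ ≤ (M.toNNReal : ℝ) := fun p => by
    rw [← (InnerProductSpace.toDual ℝ (WithLp 2 (E × F))).norm_map, toDual_gradient]
    exact norm_fderiv_le_of_lipschitz ℝ hfM
  have hinner : ‖hessxy g w y (v - (hessyy g w y).inverse (grady f w y))‖ ≤ σ / 2 := by
    have hC : ‖hessxy g w y‖ ≤ ℓ := by
      rw [hessxy_eq hgdiff2]
      refine (norm_fstL_comp_comp_inrL2_le _).trans ?_
      simpa [hℓ.le] using norm_fderiv_le_of_lipschitz ℝ hglip (x₀ := pmk w y)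
    exact ((hessxy g w y).le_of_opNorm_le_of_le hC hv).trans_eq (by field_simp)
  have houter : ‖(gradx f w (ystar w)
        - hessxy g w (ystar w) ((hessyy g w (ystar w)).inverse (grady f w (ystar w))))
      - (gradx f w y - hessxy g w y ((hessyy g w y).inverse (grady f w y)))‖ ≤ σ / 2 := by
    by_cases hneg : 0 ≤ ρ ∧ 0 ≤ M
    · obtain ⟨hρ, hM⟩ := hneg
      refine (norm_hypergradient_sub_le hμ hgdiff hgdiff2 hglip hghess (hsc w) hfm hflip
        y (ystar w)).trans ?_
      rw [Real.coe_toNNReal ρ hρ, Real.coe_toNNReal M hM, Real.coe_toNNReal ℓ hℓ.le,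
        norm_sub_rev]
      have hL : 0 < Ltil := by rw [hLtil]; positivity
      have hle : ℓ + (ρ * M / μ + ℓ * ((ℓ + ρ * M / μ) / μ)) ≤ Ltil := by
        have hslack : Ltil = ℓ + (ρ * M / μ + ℓ * ((ℓ + ρ * M / μ) / μ))
            + (ℓ ^ 2 / μ + (ℓ ^ 3 + ρ * ℓ * M) / μ ^ 2 + ρ * ℓ ^ 2 * M / μ ^ 3) := by
          rw [hLtil]; field_simp; ring
        rw [hslack]
        exact le_add_of_nonneg_right (by positivity)
      exact (mul_le_mul hle hy (norm_nonneg _) hL.le).trans_eq (by field_simp)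
    · -- With a negative constant, the gradient of `f` is constant.
      have hρM : (ρ.toNNReal : ℝ) * M.toNNReal = 0 := by
        rcases not_and_or.mp hneg with h | h <;>
          simp [Real.toNNReal_of_nonpos (not_le.mp h).le]
      have hconst : ∀ p q, gradient f p = gradient f q := fun p q => by
        rcases not_and_or.mp hneg with h | h
        · refine eq_of_fderiv_eq_of_norm_le hfdiff2 (fun p q => ?_) hfm p q
          have := hfhess.norm_sub_le p q
          rw [Real.toNNReal_of_nonpos (not_le.mp h).le, NNReal.coe_zero, zero_mul] at this
          exact sub_eq_zero.mp (norm_le_zero_iff.mp this)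
        · rw [Real.toNNReal_of_nonpos (not_le.mp h).le, NNReal.coe_zero] at hfm
          rw [norm_le_zero_iff.mp (hfm p), norm_le_zero_iff.mp (hfm q)]
      have hflip0 : LipschitzWith 0 (gradient f) :=
        LipschitzWith.of_dist_le_mul fun p q => by simp [hconst p q]
      refine (norm_hypergradient_sub_le hμ hgdiff hgdiff2 hglip hghess (hsc w) hfm hflip0
        y (ystar w)).trans ?_
      simp only [hρM, NNReal.coe_zero, zero_div, add_zero, mul_zero, zero_mul]
      positivity
  have hgrad := (hasGradientAt_comp_argmin hμ hgdiff hgdiff2 hglip hsc hmin hfdiff w).gradient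
  rw [← funext hΦ] at hgrad
  have hsplit : gradient Φ w - (gradx f w y - hessxy g w y v)
      = (gradient Φ w - (gradx f w y - hessxy g w y ((hessyy g w y).inverse (grady f w y))))
        + hessxy g w y (v - (hessyy g w y).inverse (grady f w y)) := by
    rw [map_sub]; abel
  rw [hsplit]
  refine (norm_add_le _ _).trans ?_
  rw [hgrad]
  linarith
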